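/- Suppose X ∈ ℝ^p is a multivariate Gaussian random vector with mean zero and positive definite covariance matrix Σ_X, and Y follows model (2) with all required moments finite. Then for every pair i ≤ j, the (i,j) entry ψ_{ij} of the principal Hessian matrix Ψ = Σ_X⁻¹ Σ_{YXX} Σ_X⁻¹ satisfies: ψ_{ij} = ψ_{ji}, and ψ_{ij} ≠ 0 if and only if β_{ij} ≠ 0. (Proposition 1) -/

import Mathlib

open MeasureTheory ProbabilityTheory Matrix

/-- `X` is a centered (mean-zero) Gaussian random vector with covariance matrix `Sig`:
every linear functional `⟨a, X⟩` is distributed as `N(0, aᵀ Sig a)`. -/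
def IsCenteredGaussianVec {Ω : Type*} [MeasurableSpace Ω] (μ : Measure Ω) {p : ℕ}
    (X : Ω → Fin p → ℝ) (Sig : Matrix (Fin p) (Fin p) ℝ) : Prop :=
  ∀ a : Fin p → ℝ,
    Measure.map (fun ω => ∑ i, a i * X ω i) μ =
      gaussianReal 0 (Real.toNNReal (∑ i, ∑ j, a i * Sig i j * a j))

lemma isub_fun {Ω : Type*} [MeasurableSpace Ω] {μ : Measure Ω} {f g : Ω → ℝ}
    (hf : Integrable f μ) (hg : Integrable g μ) : Integrable (fun ω => f ω - g ω) μ := hf.sub hg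

lemma iadd_fun {Ω : Type*} [MeasurableSpace Ω] {μ : Measure Ω} {f g : Ω → ℝ}
    (hf : Integrable f μ) (hg : Integrable g μ) : Integrable (fun ω => f ω + g ω) μ := hf.add hg

lemma gauss_moments (v : NNReal) :
    (∫ x, x ^ 2 ∂(gaussianReal 0 v) = v) ∧ (∫ x, x ^ 3 ∂(gaussianReal 0 v) = 0) ∧
    (∫ x, x ^ 4 ∂(gaussianReal 0 v) = 3 * (v : ℝ) ^ 2) := by
  have h0 : (0 : ℝ) ∈ interior (integrableExpSet id (gaussianReal 0 v)) := by
    simp [integrableExpSet_id_gaussianReal]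
  have H := fun n => iteratedDeriv_mgf_zero h0 n
  have hm : mgf id (gaussianReal 0 v) = fun t => Real.exp ((v : ℝ) * t ^ 2 / 2) := by
    rw [mgf_id_gaussianReal]; simp
  have hE : ∀ t : ℝ, HasDerivAt (fun t => Real.exp ((v : ℝ) * t ^ 2 / 2))
      (Real.exp ((v : ℝ) * t ^ 2 / 2) * (v * t)) t := by
    intro t
    have : HasDerivAt (fun t : ℝ => (v : ℝ) * t ^ 2 / 2) (v * t) t := by
      have := (((hasDerivAt_id t).pow 2).const_mul (v : ℝ)).div_const 2
      refine this.congr_deriv ?_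
      simp only [id]; norm_num; ring
    exact this.exp
  have d1 : iteratedDeriv 1 (mgf id (gaussianReal 0 v)) =
      fun t => Real.exp ((v : ℝ) * t ^ 2 / 2) * (v * t) := by
    rw [iteratedDeriv_one, hm]; funext t; exact (hE t).deriv
  have d2 : iteratedDeriv 2 (mgf id (gaussianReal 0 v)) =
      fun t => Real.exp ((v : ℝ) * t ^ 2 / 2) * (v + v ^ 2 * t ^ 2) := by
    rw [iteratedDeriv_succ, d1]; funext t
    have h := (hE t).mul ((hasDerivAt_id t).const_mul (v : ℝ))
    refine (h.deriv).trans ?_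
    simp; ring
  have d3 : iteratedDeriv 3 (mgf id (gaussianReal 0 v)) =
      fun t => Real.exp ((v : ℝ) * t ^ 2 / 2) * (3 * v ^ 2 * t + v ^ 3 * t ^ 3) := by
    rw [iteratedDeriv_succ, d2]; funext t
    have h := (hE t).mul ((((hasDerivAt_id t).pow 2).const_mul ((v : ℝ) ^ 2)).const_add (v : ℝ))
    refine (h.deriv).trans ?_
    simp; ring
  have d4 : iteratedDeriv 4 (mgf id (gaussianReal 0 v)) =
      fun t => Real.exp ((v : ℝ) * t ^ 2 / 2) * (3 * v ^ 2 + 6 * v ^ 3 * t ^ 2 + v ^ 4 * t ^ 4) := by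
    rw [iteratedDeriv_succ, d3]; funext t
    have h := (hE t).mul (((hasDerivAt_id t).const_mul (3 * (v : ℝ) ^ 2)).add
      (((hasDerivAt_id t).pow 3).const_mul ((v : ℝ) ^ 3)))
    refine (h.deriv).trans ?_
    simp; ring
  have H2 := H 2
  have H3 := H 3
  have H4 := H 4
  rw [d2] at H2
  rw [d3] at H3
  rw [d4] at H4
  simp at H2 H3 H4
  exact ⟨H2.symm, H3.symm, H4.symm⟩

lemma lin_moments {Ω : Type*} [MeasurableSpace Ω] {μ : Measure Ω}
    [IsProbabilityMeasure μ] {p : ℕ}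
    {X : Ω → Fin p → ℝ} (hXm : Measurable X)
    {Sig : Matrix (Fin p) (Fin p) ℝ} (hSig : Sig.PosDef)
    (hX : IsCenteredGaussianVec μ X Sig) (a : Fin p → ℝ) :
    (∀ n : ℕ, Integrable (fun ω => (∑ i, a i * X ω i) ^ n) μ) ∧
    (∫ ω, (∑ i, a i * X ω i) ∂μ = 0) ∧
    (∫ ω, (∑ i, a i * X ω i) ^ 2 ∂μ = a ⬝ᵥ (Sig *ᵥ a)) ∧
    (∫ ω, (∑ i, a i * X ω i) ^ 3 ∂μ = 0) ∧
    (∫ ω, (∑ i, a i * X ω i) ^ 4 ∂μ = 3 * (a ⬝ᵥ (Sig *ᵥ a)) ^ 2) := by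
  have hm : AEMeasurable (fun ω => ∑ i, a i * X ω i) μ := by fun_prop
  have hq : (∑ i, ∑ j, a i * Sig i j * a j) = a ⬝ᵥ (Sig *ᵥ a) := by
    simp [dotProduct, mulVec, Finset.mul_sum, mul_assoc]
  have hq0 : 0 ≤ a ⬝ᵥ (Sig *ᵥ a) := by
    simpa using hSig.posSemidef.dotProduct_mulVec_nonneg a
  have hl := hX a
  rw [hq] at hl
  have key : ∀ n : ℕ, ∫ ω, (∑ i, a i * X ω i) ^ n ∂μ
      = ∫ x, x ^ n ∂(gaussianReal 0 (Real.toNNReal (a ⬝ᵥ (Sig *ᵥ a)))) := by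
    intro n
    rw [← hl, integral_map hm (by fun_prop)]
  obtain ⟨m2, m3, m4⟩ := gauss_moments (Real.toNNReal (a ⬝ᵥ (Sig *ᵥ a)))
  rw [Real.coe_toNNReal _ hq0] at m2 m4
  refine ⟨fun n => ?_, ?_, (key 2).trans m2, (key 3).trans m3, (key 4).trans m4⟩
  · have h1 : MemLp id (n : ENNReal) (gaussianReal 0 (Real.toNNReal (a ⬝ᵥ (Sig *ᵥ a)))) :=
      memLp_id_gaussianReal' _ (by simp)
    have h2 : Integrable (fun x : ℝ => x ^ n)
        (gaussianReal 0 (Real.toNNReal (a ⬝ᵥ (Sig *ᵥ a)))) := by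
      have := h1.integrable_norm_pow'
      refine this.mono (by fun_prop) (by simp)
    rw [← hl] at h2
    exact h2.comp_aemeasurable hm
  · have := key 1
    simpa using this

/-- joint moments of a centered Gaussian vector -/
lemma joint_moments {Ω : Type*} [MeasurableSpace Ω] {μ : Measure Ω}
    [IsProbabilityMeasure μ] {p : ℕ}
    {X : Ω → Fin p → ℝ} (hXm : Measurable X)
    {Sig : Matrix (Fin p) (Fin p) ℝ} (hSig : Sig.PosDef)
    (hX : IsCenteredGaussianVec μ X Sig) (i j k l : Fin p) :
    (Integrable (fun ω => X ω i) μ ∧ ∫ ω, X ω i ∂μ = 0) ∧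
    (∫ ω, X ω i * X ω j ∂μ = Sig i j) ∧
    (Integrable (fun ω => X ω i * X ω j * X ω k) μ ∧ ∫ ω, X ω i * X ω j * X ω k ∂μ = 0) ∧
    (∫ ω, X ω i * X ω j * X ω k * X ω l ∂μ =
      Sig i j * Sig k l + Sig i k * Sig j l + Sig i l * Sig j k) := by
  have hsymm : ∀ s t, Sig s t = Sig t s := fun s t => by
    have := hSig.isHermitian.apply t s
    simpa using this
  have L := fun b c d : ℝ => lin_moments hXm hSig hX
    (Pi.single i 1 + b • Pi.single j 1 + c • Pi.single k 1 + d • Pi.single l 1)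
  have hsum : ∀ (b c d : ℝ) (ω : Ω), ∑ s, ((Pi.single i 1 + b • Pi.single j 1 + c • Pi.single k 1
      + d • Pi.single l 1 : Fin p → ℝ) s) * X ω s = X ω i + b * X ω j + c * X ω k + d * X ω l := by
    intro b c d ω
    simp [add_mul, Finset.sum_add_distrib, Pi.single_apply]
  have hquad : ∀ (b c d : ℝ), (Pi.single i 1 + b • Pi.single j 1 + c • Pi.single k 1
      + d • Pi.single l 1 : Fin p → ℝ) ⬝ᵥ (Sig *ᵥ (Pi.single i 1 + b • Pi.single j 1
      + c • Pi.single k 1 + d • Pi.single l 1 : Fin p → ℝ))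
      = Sig i i + b ^ 2 * Sig j j + c ^ 2 * Sig k k + d ^ 2 * Sig l l
        + 2 * b * Sig i j + 2 * c * Sig i k + 2 * d * Sig i l + 2 * b * c * Sig j k
        + 2 * b * d * Sig j l + 2 * c * d * Sig k l := by
    intro b c d
    simp only [mulVec_add, mulVec_smul, dotProduct_add, add_dotProduct, smul_dotProduct,
      dotProduct_smul, mulVec_single_one, single_one_dotProduct, smul_eq_mul, col_apply]
    rw [hsymm j i, hsymm k i, hsymm l i, hsymm k j, hsymm l j, hsymm l k]
    ring
  simp only [hsum, hquad] at L
  refine ⟨⟨?_, ?_⟩, ?_, ⟨?_, ?_⟩, ?_⟩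
  · simpa using (L 0 0 0).1 1
  · simpa using (L 0 0 0).2.1
  · have e : ∀ ω, X ω i * X ω j = (1 / 4) * ((X ω i + 1 * X ω j + 0 * X ω k + 0 * X ω l) ^ 2
      - (X ω i + (-1) * X ω j + 0 * X ω k + 0 * X ω l) ^ 2) := by intro ω; ring
    simp only [e]
    rw [integral_const_mul, integral_sub ((L _ _ _).1 2) ((L _ _ _).1 2), (L _ _ _).2.2.1,
      (L _ _ _).2.2.1]
    ring
  · have e : (fun ω => X ω i * X ω j * X ω k) = fun ω => (1 / 24) *
      ((X ω i + 1 * X ω j + 1 * X ω k + 0 * X ω l) ^ 3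
      - (X ω i + 1 * X ω j + (-1) * X ω k + 0 * X ω l) ^ 3
      - (X ω i + (-1) * X ω j + 1 * X ω k + 0 * X ω l) ^ 3
      + (X ω i + (-1) * X ω j + (-1) * X ω k + 0 * X ω l) ^ 3) := by funext ω; ring
    rw [e]
    exact (((((L _ _ _).1 3).sub ((L _ _ _).1 3)).sub ((L _ _ _).1 3)).add
      ((L _ _ _).1 3)).const_mul _
  · have e : (fun ω => X ω i * X ω j * X ω k) = fun ω => (1 / 24) *
      ((X ω i + 1 * X ω j + 1 * X ω k + 0 * X ω l) ^ 3
      - (X ω i + 1 * X ω j + (-1) * X ω k + 0 * X ω l) ^ 3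
      - (X ω i + (-1) * X ω j + 1 * X ω k + 0 * X ω l) ^ 3
      + (X ω i + (-1) * X ω j + (-1) * X ω k + 0 * X ω l) ^ 3) := by funext ω; ring
    rw [e, integral_const_mul, integral_add
      (isub_fun (isub_fun ((L _ _ _).1 3) ((L _ _ _).1 3)) ((L _ _ _).1 3)) ((L _ _ _).1 3),
      integral_sub (isub_fun ((L _ _ _).1 3) ((L _ _ _).1 3)) ((L _ _ _).1 3),
      integral_sub ((L _ _ _).1 3) ((L _ _ _).1 3),
      (L _ _ _).2.2.2.1, (L _ _ _).2.2.2.1, (L _ _ _).2.2.2.1, (L _ _ _).2.2.2.1]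
    ring
  · have e : (fun ω => X ω i * X ω j * X ω k * X ω l) = fun ω => (1 / 192) * (
      ((X ω i + 1 * X ω j + 1 * X ω k + 1 * X ω l) ^ 4
      - (X ω i + 1 * X ω j + 1 * X ω k + (-1) * X ω l) ^ 4)
      - ((X ω i + 1 * X ω j + (-1) * X ω k + 1 * X ω l) ^ 4
      - (X ω i + 1 * X ω j + (-1) * X ω k + (-1) * X ω l) ^ 4)
      - (((X ω i + (-1) * X ω j + 1 * X ω k + 1 * X ω l) ^ 4
      - (X ω i + (-1) * X ω j + 1 * X ω k + (-1) * X ω l) ^ 4)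
      - ((X ω i + (-1) * X ω j + (-1) * X ω k + 1 * X ω l) ^ 4
      - (X ω i + (-1) * X ω j + (-1) * X ω k + (-1) * X ω l) ^ 4))) := by funext ω; ring
    have D := fun b c d b' c' d' => isub_fun ((L b c d).1 4) ((L b' c' d').1 4)
    have I := fun b c d b' c' d' => integral_sub ((L b c d).1 4) ((L b' c' d').1 4)
    rw [e, integral_const_mul, integral_sub (isub_fun (D _ _ _ _ _ _) (D _ _ _ _ _ _))
      (isub_fun (D _ _ _ _ _ _) (D _ _ _ _ _ _)), integral_sub (D _ _ _ _ _ _) (D _ _ _ _ _ _),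
      integral_sub (D _ _ _ _ _ _) (D _ _ _ _ _ _), I, I, I, I]
    simp only [fun b c d => (L b c d).2.2.2.2]
    ring

/-- **Proposition 1.** Suppose `X ~ N(0, Σ_X)` with `Σ_X` positive definite, and `Y` follows
model (2): `Y = Σ_i θ_i X_i + Σ_{i ≤ j} β_{ij} X_i X_j + ε` with `ε` mean-zero and
independent of `X`, all required moments being finite. Then for every `i ≤ j`, the entries
of the principal Hessian matrix `Ψ = Σ_X⁻¹ Σ_{YXX} Σ_X⁻¹` (where
`Σ_{YXX} = E[(Y − EY)XXᵀ]`) satisfy `ψ_{ij} = ψ_{ji}` and `ψ_{ij} ≠ 0 ↔ β_{ij} ≠ 0`. -/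
theorem proposition1 {Ω : Type*} [MeasurableSpace Ω] (μ : Measure Ω)
    [IsProbabilityMeasure μ] {p : ℕ}
    (X : Ω → Fin p → ℝ) (hXm : Measurable X)
    (Sig : Matrix (Fin p) (Fin p) ℝ) (hSig : Sig.PosDef)
    (hX : IsCenteredGaussianVec μ X Sig)
    (θ : Fin p → ℝ) (β : Fin p → Fin p → ℝ)
    (ε : Ω → ℝ) (hεm : Measurable ε) (hindep : IndepFun ε X μ)
    (hεint : Integrable ε μ) (hεmean : ∫ ω, ε ω ∂μ = 0)
    (Y : Ω → ℝ)
    (hY : ∀ ω, Y ω = ∑ i, θ i * X ω i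
        + ∑ i, ∑ j ∈ Finset.Ici i, β i j * X ω i * X ω j + ε ω)
    -- all required moments are finite
    (hYint : Integrable Y μ)
    (hYXX : ∀ k l : Fin p, Integrable (fun ω => Y ω * X ω k * X ω l) μ)
    (hmom4 : ∀ i j k l : Fin p, Integrable (fun ω => X ω i * X ω j * X ω k * X ω l) μ)
    (hmom2 : ∀ i j : Fin p, Integrable (fun ω => X ω i * X ω j) μ)
    (Syxx Ψ : Matrix (Fin p) (Fin p) ℝ)
    (hSyxx : ∀ k l, Syxx k l = ∫ ω, (Y ω - ∫ ω', Y ω' ∂μ) * (X ω k * X ω l) ∂μ)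
    (hΨ : Ψ = Sig⁻¹ * Syxx * Sig⁻¹) :
    ∀ i j : Fin p, i ≤ j → Ψ i j = Ψ j i ∧ (Ψ i j ≠ 0 ↔ β i j ≠ 0) := by
  have hsymm : ∀ s t, Sig s t = Sig t s := fun s t => by
    have := hSig.isHermitian.apply t s
    simpa using this
  have J := joint_moments hXm hSig hX
  obtain ⟨B, hBd⟩ : ∃ B : Matrix (Fin p) (Fin p) ℝ,
      ∀ i j, B i j = if i ≤ j then β i j else 0 := ⟨fun i j => if i ≤ j then β i j else 0, fun _ _ => rfl⟩
  have hB : ∀ (f : Fin p → Fin p → ℝ), ∑ i, ∑ j ∈ Finset.Ici i, β i j * f i j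
      = ∑ i, ∑ j, B i j * f i j := by
    intro f
    refine Finset.sum_congr rfl fun i _ => ?_
    have : (Finset.Ici i) = Finset.univ.filter (fun j => i ≤ j) := by ext; simp
    rw [this, Finset.sum_filter]
    refine Finset.sum_congr rfl fun j _ => ?_
    simp only [hBd]
    split_ifs <;> simp
  have hY' : ∀ ω, Y ω = ∑ i, θ i * X ω i + ∑ i, ∑ j, B i j * (X ω i * X ω j) + ε ω := by
    intro ω
    rw [hY ω, ← hB]
    simp only [mul_assoc]
  have hεXX : ∀ k l, Integrable (fun ω => ε ω * (X ω k * X ω l)) μ ∧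
      ∫ ω, ε ω * (X ω k * X ω l) ∂μ = 0 := by
    intro k l
    have hi : IndepFun ε (fun ω => X ω k * X ω l) μ :=
      hindep.comp (φ := id) (ψ := fun x : Fin p → ℝ => x k * x l) measurable_id (by fun_prop)
    refine ⟨hi.integrable_mul hεint (hmom2 k l), ?_⟩
    rw [hi.integral_fun_mul_eq_mul_integral hεint.1 (hmom2 k l).1, hεmean, zero_mul]
  -- mean of Y
  have hEY : ∫ ω, Y ω ∂μ = ∑ i, ∑ j, B i j * Sig i j := by
    have i1 : Integrable (fun ω => ∑ i, θ i * X ω i) μ :=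
      integrable_finsetSum _ fun i _ => (J i i i i).1.1.const_mul _
    have i2 : Integrable (fun ω => ∑ i, ∑ j, B i j * (X ω i * X ω j)) μ :=
      integrable_finsetSum _ fun i _ => integrable_finsetSum _ fun j _ =>
        (hmom2 i j).const_mul _
    have e2 : ∫ ω, ∑ i, ∑ j, B i j * (X ω i * X ω j) ∂μ =
        ∑ i, ∫ ω, ∑ j, B i j * (X ω i * X ω j) ∂μ :=
      integral_finsetSum _ (fun i _ => integrable_finsetSum _ fun j _ =>
        (hmom2 i j).const_mul _)
    simp only [hY']
    rw [integral_add (iadd_fun i1 i2) hεint, integral_add i1 i2, hεmean,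
      integral_finsetSum _ (fun i _ => (J i i i i).1.1.const_mul _),
      e2]
    have e1 : ∀ i, ∫ ω, X ω i ∂μ = 0 := fun i => (J i i i i).1.2
    simp only [integral_const_mul, e1, mul_zero, Finset.sum_const_zero, zero_add, add_zero]
    refine Finset.sum_congr rfl fun i _ => ?_
    rw [integral_finsetSum _ (fun j _ => (hmom2 i j).const_mul _)]
    refine Finset.sum_congr rfl fun j _ => ?_
    rw [integral_const_mul, (J i j i i).2.1]
  have hS : Syxx = Sig * (B + Bᵀ) * Sig := by
    ext k l
    rw [hSyxx k l, hEY]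
    have e : ∀ ω, (Y ω - ∑ i, ∑ j, B i j * Sig i j) * (X ω k * X ω l) =
        ∑ i, θ i * (X ω i * X ω k * X ω l)
        + ∑ i, ∑ j, B i j * (X ω i * X ω j * X ω k * X ω l)
        + ε ω * (X ω k * X ω l) - (∑ i, ∑ j, B i j * Sig i j) * (X ω k * X ω l) := by
      intro ω
      rw [hY' ω]
      simp only [sub_mul, add_mul, Finset.sum_mul, mul_assoc]
    have i1 : Integrable (fun ω => ∑ i, θ i * (X ω i * X ω k * X ω l)) μ :=
      integrable_finsetSum _ fun i _ => (J i k l i).2.2.1.1.const_mul _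
    have i2 : Integrable (fun ω => ∑ i, ∑ j, B i j * (X ω i * X ω j * X ω k * X ω l)) μ :=
      integrable_finsetSum _ fun i _ => integrable_finsetSum _ fun j _ =>
        (hmom4 i j k l).const_mul _
    have e0 : ∫ ω, ∑ i, ∑ j, B i j * (X ω i * X ω j * X ω k * X ω l) ∂μ =
        ∑ i, ∫ ω, ∑ j, B i j * (X ω i * X ω j * X ω k * X ω l) ∂μ :=
      integral_finsetSum _ (fun i _ => integrable_finsetSum _ fun j _ =>
        (hmom4 i j k l).const_mul _)
    simp only [e]
    rw [integral_sub (iadd_fun (iadd_fun i1 i2) (hεXX k l).1) ((hmom2 k l).const_mul _),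
      integral_add (iadd_fun i1 i2) (hεXX k l).1, integral_add i1 i2, (hεXX k l).2,
      integral_const_mul, (J k l k k).2.1,
      integral_finsetSum _ (fun i _ => (J i k l i).2.2.1.1.const_mul _),
      e0]
    have e1 : ∀ i, ∫ ω, X ω i * X ω k * X ω l ∂μ = 0 := fun i => (J i k l i).2.2.1.2
    have e2 : ∀ i, ∫ ω, ∑ j, B i j * (X ω i * X ω j * X ω k * X ω l) ∂μ =
        ∑ j, B i j * (Sig i j * Sig k l + Sig i k * Sig j l + Sig i l * Sig j k) := by
      intro i
      rw [integral_finsetSum _ (fun j _ => (hmom4 i j k l).const_mul _)]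
      refine Finset.sum_congr rfl fun j _ => ?_
      rw [integral_const_mul, (J i j k l).2.2.2]
    simp only [integral_const_mul, e1, e2, mul_zero, Finset.sum_const_zero, zero_add, add_zero]
    have r1 : (Sig * B * Sig) k l = ∑ i, ∑ j, B i j * (Sig i k * Sig j l) := by
      simp only [Matrix.mul_apply, Finset.sum_mul]
      rw [Finset.sum_comm]
      refine Finset.sum_congr rfl fun i _ => Finset.sum_congr rfl fun j _ => ?_
      rw [hsymm k i]; ring
    have r2 : (Sig * Bᵀ * Sig) k l = ∑ i, ∑ j, B i j * (Sig i l * Sig j k) := by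
      simp only [Matrix.mul_apply, Finset.sum_mul, Matrix.transpose_apply]
      refine Finset.sum_congr rfl fun i _ => Finset.sum_congr rfl fun j _ => ?_
      rw [hsymm k j]; ring
    rw [Matrix.mul_add, Matrix.add_mul, Matrix.add_apply, r1, r2]
    simp only [Finset.sum_mul, ← Finset.sum_add_distrib, ← Finset.sum_sub_distrib]
    refine Finset.sum_congr rfl fun i _ => Finset.sum_congr rfl fun j _ => ?_
    ring
  have hdet : IsUnit Sig.det := hSig.isUnit.map Matrix.detMonoidHom
  have hΨ' : Ψ = B + Bᵀ := by
    rw [hΨ, hS, Matrix.mul_assoc Sig, Matrix.nonsing_inv_mul_cancel_left _ _ hdet,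
      Matrix.mul_nonsing_inv_cancel_right _ _ hdet]
  intro i j hij
  rw [hΨ']
  simp only [Matrix.add_apply, Matrix.transpose_apply]
  refine ⟨add_comm _ _, ?_⟩
  rcases hij.eq_or_lt with rfl | h
  · simp [hBd]
  · simp [hBd, hij, not_le.mpr h]
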